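/- If (M,μ) is an (A,B)-Yetter-Drinfeld Hom-module and (N,ν) is a (C,D)-Yetter-Drinfeld Hom-module over H, then M⊗N with action h·(m⊗n) = C(h₁)·m ⊗ (C⁻¹∘B∘C)(h₂)·n and coaction m⊗n ↦ (m₍₀₎⊗n₍₀₎) ⊗ n₍₁₎m₍₁₎ is an (AC, DC⁻¹BC)-Yetter-Drinfeld Hom-module, with structure automorphism μ⊗ν. -/

import Mathlib

open TensorProduct

/-- A monoidal Hom-Hopf algebra (with bijective antipode) over a field `k`. -/
structure HomHopf (k : Type*) [Field k] (H : Type*) [AddCommGroup H] [Module k H] where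
  mul : H →ₗ[k] H →ₗ[k] H
  one : H
  a : H ≃ₗ[k] H
  comul : H →ₗ[k] H ⊗[k] H
  counit : H →ₗ[k] k
  S : H ≃ₗ[k] H
  hom_assoc : ∀ x y z : H, mul (a x) (mul y z) = mul (mul x y) (a z)
  a_mul : ∀ x y : H, a (mul x y) = mul (a x) (a y)
  mul_one' : ∀ x : H, mul x one = a x
  one_mul' : ∀ x : H, mul one x = a x
  a_one : a one = one
  hom_coassoc : (TensorProduct.map a.symm.toLinearMap comul).comp comul
      = (TensorProduct.assoc k H H H).toLinearMap.comp
          ((TensorProduct.map comul a.symm.toLinearMap).comp comul)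
  comul_a : ∀ x : H, comul (a x) = TensorProduct.map a.toLinearMap a.toLinearMap (comul x)
  counit_comul : ∀ x : H,
    (TensorProduct.lid k H) ((TensorProduct.map counit LinearMap.id) (comul x)) = a.symm x
  comul_counit : ∀ x : H,
    (TensorProduct.rid k H) ((TensorProduct.map LinearMap.id counit) (comul x)) = a.symm x
  counit_a : ∀ x : H, counit (a x) = counit x
  comul_mul : ∀ x y : H, comul (mul x y)
      = (TensorProduct.map (TensorProduct.lift mul) (TensorProduct.lift mul))
          ((TensorProduct.tensorTensorTensorComm k H H H H) (comul x ⊗ₜ[k] comul y))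
  comul_one : comul one = one ⊗ₜ[k] one
  counit_mul : ∀ x y : H, counit (mul x y) = counit x * counit y
  counit_one : counit one = 1
  S_a : ∀ x : H, S (a x) = a (S x)
  antipode_left : ∀ x : H,
    (TensorProduct.lift mul) ((TensorProduct.map S.toLinearMap LinearMap.id) (comul x))
      = counit x • one
  antipode_right : ∀ x : H,
    (TensorProduct.lift mul) ((TensorProduct.map LinearMap.id S.toLinearMap) (comul x))
      = counit x • one

/-- A monoidal Hom-Hopf algebra automorphism. -/
structure IsHomHopfAuto {k : Type*} [Field k] {H : Type*} [AddCommGroup H] [Module k H]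
    (HH : HomHopf k H) (f : H ≃ₗ[k] H) : Prop where
  map_mul : ∀ x y : H, f (HH.mul x y) = HH.mul (f x) (f y)
  map_one : f HH.one = HH.one
  map_comul : ∀ x : H, HH.comul (f x)
      = TensorProduct.map f.toLinearMap f.toLinearMap (HH.comul x)
  map_counit : ∀ x : H, HH.counit (f x) = HH.counit x
  map_a : ∀ x : H, f (HH.a x) = HH.a (f x)

/-- A left-right (A,B)-Yetter-Drinfeld Hom-module over `HH`. -/
structure YDModule {k : Type*} [Field k] {H : Type*} [AddCommGroup H] [Module k H]
    (HH : HomHopf k H) (A B : H ≃ₗ[k] H)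
    (M : Type*) [AddCommGroup M] [Module k M] where
  act : H →ₗ[k] M →ₗ[k] M
  coact : M →ₗ[k] M ⊗[k] H
  mu : M ≃ₗ[k] M
  hom_act : ∀ (h g : H) (m : M), act (HH.a h) (act g m) = act (HH.mul h g) (mu m)
  mu_act : ∀ (h : H) (m : M), mu (act h m) = act (HH.a h) (mu m)
  one_act : ∀ m : M, act HH.one m = mu m
  hom_coact : (TensorProduct.map mu.symm.toLinearMap HH.comul).comp coact
      = (TensorProduct.assoc k M H H).toLinearMap.comp
          ((TensorProduct.map coact HH.a.symm.toLinearMap).comp coact)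
  coact_mu : ∀ m : M, coact (mu m)
      = TensorProduct.map mu.toLinearMap HH.a.toLinearMap (coact m)
  coact_counit : ∀ m : M,
    (TensorProduct.rid k M) ((TensorProduct.map LinearMap.id HH.counit) (coact m)) = mu.symm m
  compat : ∀ (h : H) (m : M) (n : ℕ) (h1 h2 : Fin n → H),
      HH.comul h = ∑ i, h1 i ⊗ₜ[k] h2 i →
      ∀ (p : ℕ) (h21 h22 : Fin n → Fin p → H),
      (∀ i, HH.comul (h2 i) = ∑ j, h21 i j ⊗ₜ[k] h22 i j) →
      ∀ (q : ℕ) (m0 : Fin q → M) (m1 : Fin q → H),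
      coact m = ∑ l, m0 l ⊗ₜ[k] m1 l →
      coact (act h m) = ∑ i, ∑ j, ∑ l,
        act (HH.a (h21 i j)) (m0 l) ⊗ₜ[k]
          HH.mul (HH.mul (B (h22 i j)) (HH.a.symm (m1 l))) (A (HH.S.symm (h1 i)))


section Untwist

variable {k : Type*} [Field k] {H : Type*} [AddCommGroup H] [Module k H]

namespace HomHopf

variable (HH : HomHopf k H)

lemma a_symm_mul (x y : H) : HH.a.symm (HH.mul x y) = HH.mul (HH.a.symm x) (HH.a.symm y) := by
  apply HH.a.injective
  simp [HH.a_mul]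

lemma comul_a_symm (x : H) : HH.comul (HH.a.symm x)
    = TensorProduct.map HH.a.symm.toLinearMap HH.a.symm.toLinearMap (HH.comul x) := by
  conv_rhs => rw [← HH.a.apply_symm_apply x, HH.comul_a]
  generalize HH.comul (HH.a.symm x) = u
  induction u with
  | zero => simp
  | add u v hu hv => rw [map_add, map_add, ← hu, ← hv]
  | tmul x y => simp

/-- The ordinary ring obtained by untwisting the multiplication with `a⁻¹`. -/
abbrev untwistRing : Ring H :=
  { ‹AddCommGroup H› with
    mul := fun x y => HH.a.symm (HH.mul x y)
    one := HH.one
    left_distrib := fun x y z => by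
      change HH.a.symm (HH.mul x (y + z)) = HH.a.symm _ + HH.a.symm _
      simp
    right_distrib := fun x y z => by
      change HH.a.symm (HH.mul (x + y) z) = HH.a.symm _ + HH.a.symm _
      simp
    zero_mul := fun x => by
      change HH.a.symm (HH.mul 0 x) = 0
      simp
    mul_zero := fun x => by
      change HH.a.symm (HH.mul x 0) = 0
      simp
    mul_assoc := fun x y z => by
      change HH.a.symm (HH.mul (HH.a.symm (HH.mul x y)) z)
        = HH.a.symm (HH.mul x (HH.a.symm (HH.mul y z)))
      have h := HH.hom_assoc (HH.a.symm x) (HH.a.symm y) (HH.a.symm z)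
      rw [HH.a.apply_symm_apply, HH.a.apply_symm_apply] at h
      rw [HH.a_symm_mul x y, HH.a_symm_mul y z, h]
    one_mul := fun x => by
      change HH.a.symm (HH.mul HH.one x) = x
      rw [HH.one_mul', HH.a.symm_apply_apply]
    mul_one := fun x => by
      change HH.a.symm (HH.mul x HH.one) = x
      rw [HH.mul_one', HH.a.symm_apply_apply] }

/-- The algebra structure on the untwisted ring. -/
abbrev untwistAlgebra : letI := HH.untwistRing; Algebra k H :=
  letI := HH.untwistRing
  Algebra.ofModule
    (fun r x y => by
      change HH.a.symm (HH.mul (r • x) y) = r • HH.a.symm (HH.mul x y)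
      simp)
    (fun r x y => by
      change HH.a.symm (HH.mul x (r • y)) = r • HH.a.symm (HH.mul x y)
      simp)

/-- The ordinary coalgebra obtained by untwisting the comultiplication with `a`. -/
abbrev untwistCoalgebra : Coalgebra k H where
  comul := (TensorProduct.map HH.a.toLinearMap HH.a.toLinearMap).comp HH.comul
  counit := HH.counit
  coassoc := by
    ext x
    have h := congr(TensorProduct.map (HH.a.toLinearMap.comp HH.a.toLinearMap)
      (TensorProduct.map (HH.a.toLinearMap.comp HH.a.toLinearMap)
        (HH.a.toLinearMap.comp HH.a.toLinearMap)) ($(HH.hom_coassoc) x))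
    simp only [LinearMap.comp_apply, LinearEquiv.coe_coe] at h ⊢
    refine Eq.trans ?_ (h.symm.trans ?_) <;> generalize HH.comul x = u <;>
      induction u with
      | zero => simp
      | add u v hu hv => simp only [map_add, hu, hv]
      | tmul y z => ?_
    · simp only [TensorProduct.map_tmul, LinearMap.rTensor_tmul, LinearMap.comp_apply,
        LinearEquiv.coe_coe, HH.comul_a]
      generalize HH.comul y = u
      induction u with
      | zero => simp
      | add u v hu hv => simp only [map_add, TensorProduct.add_tmul, hu, hv]
      | tmul y z => simp
    · simp only [TensorProduct.map_tmul, LinearMap.lTensor_tmul, LinearMap.comp_apply,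
        LinearEquiv.coe_coe, HH.comul_a, HH.a.apply_symm_apply, TensorProduct.map_map]
  rTensor_counit_comp_comul := by
    ext x
    have h := congr((1 : k) ⊗ₜ[k] HH.a $(HH.counit_comul x))
    rw [HH.a.apply_symm_apply] at h
    refine Eq.trans ?_ h
    simp only [LinearMap.comp_apply]
    generalize HH.comul x = u
    induction u with
    | zero => simp
    | add u v hu hv => simp only [map_add, TensorProduct.tmul_add, hu, hv]
    | tmul y z => simp [HH.counit_a, TensorProduct.smul_tmul']
  lTensor_counit_comp_comul := by
    ext x
    have h := congr(HH.a $(HH.comul_counit x) ⊗ₜ[k] (1 : k))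
    rw [HH.a.apply_symm_apply] at h
    refine Eq.trans ?_ h
    simp only [LinearMap.comp_apply]
    generalize HH.comul x = u
    induction u with
    | zero => simp
    | add u v hu hv => simp only [map_add, TensorProduct.add_tmul, hu, hv]
    | tmul y z => simp [HH.counit_a, TensorProduct.smul_tmul]

/-- The ordinary Hopf algebra obtained by untwisting a monoidal Hom-Hopf algebra. -/
abbrev untwistHopf : letI := HH.untwistRing; HopfAlgebra k H :=
  letI := HH.untwistRing
  letI := HH.untwistAlgebra
  letI := HH.untwistCoalgebra
  letI : Bialgebra k H := Bialgebra.mk' k H HH.counit_one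
    (fun {x y} => by
      change HH.counit (HH.a.symm (HH.mul x y)) = _
      rw [← HH.counit_a, HH.a.apply_symm_apply, HH.counit_mul]
      rfl)
    (by
      change TensorProduct.map _ _ (HH.comul HH.one) = HH.one ⊗ₜ[k] HH.one
      rw [HH.comul_one]
      simp [HH.a_one])
    (fun {x y} => by
      change TensorProduct.map _ _ (HH.comul (HH.a.symm (HH.mul x y)))
        = TensorProduct.map _ _ (HH.comul x) * TensorProduct.map _ _ (HH.comul y)
      rw [HH.comul_a_symm, HH.comul_mul, TensorProduct.map_map]
      generalize HH.comul x = u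
      generalize HH.comul y = v
      induction u with
      | zero => simp
      | add u v hu hv => simp only [map_add, TensorProduct.add_tmul, add_mul, hu, hv]
      | tmul p q =>
        induction v with
        | zero => simp
        | add u v hu hv => simp only [map_add, TensorProduct.tmul_add, mul_add, hu, hv]
        | tmul r s =>
          simp only [TensorProduct.map_tmul, Algebra.TensorProduct.tmul_mul_tmul]
          change _ = HH.a.symm (HH.mul _ _) ⊗ₜ[k] HH.a.symm (HH.mul _ _)
          simp [HH.a_symm_mul])
  { antipode := HH.S.toLinearMap
    mul_antipode_rTensor_comul := by
      ext x
      refine Eq.trans ?_ (HH.antipode_left x)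
      change LinearMap.mul' k H (LinearMap.rTensor H _ (TensorProduct.map _ _ (HH.comul x))) = _
      generalize HH.comul x = u
      induction u with
      | zero => simp
      | add u v hu hv => simp only [map_add, hu, hv]
      | tmul y z =>
        change HH.a.symm (HH.mul (HH.S (HH.a y)) (HH.a z)) = _
        simp [HH.S_a, HH.a_symm_mul]
    mul_antipode_lTensor_comul := by
      ext x
      refine Eq.trans ?_ (HH.antipode_right x)
      change LinearMap.mul' k H (LinearMap.lTensor H _ (TensorProduct.map _ _ (HH.comul x))) = _
      generalize HH.comul x = u
      induction u with
      | zero => simp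
      | add u v hu hv => simp only [map_add, hu, hv]
      | tmul y z =>
        change HH.a.symm (HH.mul (HH.a y) (HH.S (HH.a z))) = _
        simp [HH.S_a, HH.a_symm_mul] }

lemma S_one : HH.S HH.one = HH.one := by
  have h := HH.antipode_left HH.one
  rw [HH.comul_one, HH.counit_one, one_smul] at h
  have h' : HH.mul (HH.S HH.one) HH.one = HH.one := by simpa using h
  rw [HH.mul_one'] at h'
  exact HH.a.injective (h'.trans HH.a_one.symm)

lemma S_mul (x y : H) : HH.S (HH.mul x y) = HH.mul (HH.S y) (HH.S x) := by
  let := HH.untwistRing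
  let := HH.untwistHopf
  have h : HH.S (HH.a.symm (HH.mul x y)) = HH.a.symm (HH.mul (HH.S y) (HH.S x)) :=
    HopfAlgebra.antipode_mul_antidistrib (R := k) x y
  apply HH.a.symm.injective
  rw [← h]
  apply HH.a.injective
  rw [← HH.S_a]
  simp

end HomHopf

lemma IsHomHopfAuto.map_S {HH : HomHopf k H} {f : H ≃ₗ[k] H} (hf : IsHomHopfAuto HH f) (x : H) :
    f (HH.S x) = HH.S (f x) := by
  let := HH.untwistRing
  let := HH.untwistHopf
  have ha : ∀ x, f (HH.a.symm x) = HH.a.symm (f x) := fun x => by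
    rw [LinearEquiv.eq_symm_apply, ← hf.map_a, HH.a.apply_symm_apply]
  have hmul : ∀ x y : H, f (x * y) = f x * f y := fun x y => by
    change f (HH.a.symm (HH.mul x y)) = HH.a.symm (HH.mul (f x) (f y))
    rw [ha, hf.map_mul]
  have hcomul (x : H) : TensorProduct.map f.toLinearMap f.toLinearMap (Coalgebra.comul (R := k) x)
      = Coalgebra.comul (R := k) (f x) := by
    change TensorProduct.map _ _ (TensorProduct.map _ _ (HH.comul x))
      = TensorProduct.map _ _ (HH.comul (f x))
    rw [hf.map_comul, TensorProduct.map_map, TensorProduct.map_map]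
    congr 2 <;> ext y <;> simp [hf.map_a]
  have key : WithConv.toConv (f.toLinearMap ∘ₗ HH.S.toLinearMap)
      = WithConv.toConv (HH.S.toLinearMap ∘ₗ f.toLinearMap) := by
    apply left_inv_eq_right_inv (a := WithConv.toConv f.toLinearMap)
    · ext x
      rw [(Coalgebra.Repr.arbitrary k x).convMul_apply]
      have h := congr(f $(HopfAlgebra.sum_antipode_mul_eq_smul (Coalgebra.Repr.arbitrary k x)))
      rw [map_sum, map_smul] at h
      simp only [hmul] at h
      refine h.trans ?_
      rw [LinearMap.convOne_apply, Algebra.algebraMap_eq_smul_one]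
      exact congr(HH.counit x • $hf.map_one)
    · ext x
      have h := HopfAlgebra.mul_antipode_lTensor_comul_apply (R := k) (f x)
      rw [← hcomul] at h
      rw [LinearMap.convMul_apply, LinearMap.convOne_apply]
      refine Eq.trans ?_ (h.trans ?_)
      · rw [LinearMap.lTensor, TensorProduct.map_map]
        rfl
      · exact congr(algebraMap k H $(hf.map_counit x))
  exact congr($key x)

namespace HomHopf

variable (HH : HomHopf k H)

lemma S_symm_a (x : H) : HH.S.symm (HH.a x) = HH.a (HH.S.symm x) := by
  apply HH.S.injective
  simp [HH.S_a]

lemma S_symm_a_symm (x : H) : HH.S.symm (HH.a.symm x) = HH.a.symm (HH.S.symm x) := by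
  apply HH.a.injective
  rw [← HH.S_symm_a]
  simp

/-- The linear map `x ⊗ y ↦ S⁻¹(y) x`. -/
noncomputable def mulAntipodeSymm : H ⊗[k] H →ₗ[k] H :=
  TensorProduct.lift HH.mul ∘ₗ TensorProduct.map HH.S.symm.toLinearMap LinearMap.id ∘ₗ
    (TensorProduct.comm k H H).toLinearMap

@[simp] lemma mulAntipodeSymm_tmul (x y : H) :
    HH.mulAntipodeSymm (x ⊗ₜ[k] y) = HH.mul (HH.S.symm y) x := by
  simp [mulAntipodeSymm]

lemma mulAntipodeSymm_comul (x : H) :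
    HH.mulAntipodeSymm (HH.comul x) = HH.counit x • HH.one := by
  apply HH.S.injective
  rw [map_smul, HH.S_one, ← HH.antipode_left]
  generalize HH.comul x = u
  induction u with
  | zero => simp
  | add u v hu hv => simp only [map_add, hu, hv]
  | tmul y z => simp [HH.S_mul]

lemma coassoc_map {U V W : Type*} [AddCommGroup U] [Module k U] [AddCommGroup V] [Module k V]
    [AddCommGroup W] [Module k W] (f : H →ₗ[k] U) (g : H →ₗ[k] V) (g' : H →ₗ[k] W) (x : H) :
    TensorProduct.map f (TensorProduct.map g g' ∘ₗ HH.comul) (HH.comul x)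
      = TensorProduct.assoc k U V W (TensorProduct.map
          (TensorProduct.map (f ∘ₗ HH.a.toLinearMap) g ∘ₗ HH.comul)
          (g' ∘ₗ HH.a.symm.toLinearMap) (HH.comul x)) := by
  have h := congr(TensorProduct.map (f ∘ₗ HH.a.toLinearMap) (TensorProduct.map g g')
    ($(HH.hom_coassoc) x))
  simp only [LinearMap.comp_apply, LinearEquiv.coe_coe] at h
  refine Eq.trans ?_ (h.trans ?_) <;> generalize HH.comul x = u <;>
    induction u with
    | zero => simp
    | add u v hu hv => simp only [map_add, hu, hv]
    | tmul y z => ?_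
  · simp
  · simp only [TensorProduct.map_tmul, LinearMap.comp_apply, LinearEquiv.coe_coe]
    generalize HH.comul y = u
    induction u with
    | zero => simp
    | add u v hu hv => simp only [map_add, TensorProduct.add_tmul, hu, hv]
    | tmul y z => simp

lemma coassoc_map_symm {U V W : Type*} [AddCommGroup U] [Module k U] [AddCommGroup V]
    [Module k V] [AddCommGroup W] [Module k W] (f : H →ₗ[k] U) (g : H →ₗ[k] V)
    (g' : H →ₗ[k] W) (x : H) :
    TensorProduct.map (TensorProduct.map f g ∘ₗ HH.comul) g' (HH.comul x)
      = (TensorProduct.assoc k U V W).symm (TensorProduct.map (f ∘ₗ HH.a.symm.toLinearMap)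
          (TensorProduct.map g (g' ∘ₗ HH.a.toLinearMap) ∘ₗ HH.comul) (HH.comul x)) := by
  rw [HH.coassoc_map, LinearEquiv.symm_apply_apply]
  simp [LinearMap.comp_assoc]

/-- The iterated comultiplication `h ↦ h₁ ⊗ (h₂₁ ⊗ h₂₂)`. -/
noncomputable def comul₃ : H →ₗ[k] H ⊗[k] (H ⊗[k] H) :=
  TensorProduct.map LinearMap.id HH.comul ∘ₗ HH.comul

/-- Regrouping `h₁₁ ⊗ (h₁₂₁ ⊗ h₁₂₂) ⊗ (h₂₁ ⊗ (h₂₂₁ ⊗ h₂₂₂))` so that its third and fourth factors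
arise from a single comultiplication. -/
lemma comul₃_comul₃_comul (x : H) :
    TensorProduct.map HH.comul₃ HH.comul₃ (HH.comul x)
      = (TensorProduct.assoc k _ _ _).symm (TensorProduct.map HH.a.symm.toLinearMap
          ((TensorProduct.assoc k _ _ _).symm.toLinearMap ∘ₗ
            TensorProduct.map HH.a.symm.toLinearMap
              ((TensorProduct.assoc k _ _ _).toLinearMap ∘ₗ
                TensorProduct.map
                  (TensorProduct.map HH.a.toLinearMap
                    (HH.a.toLinearMap ∘ₗ HH.a.toLinearMap) ∘ₗ HH.comul)
                  (TensorProduct.map HH.a.toLinearMap HH.a.toLinearMap ∘ₗ HH.comul) ∘ₗ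
                HH.comul) ∘ₗ
            HH.comul)
          (HH.comul x)) := by
  have ha : HH.comul ∘ₗ HH.a.toLinearMap
      = TensorProduct.map HH.a.toLinearMap HH.a.toLinearMap ∘ₗ HH.comul := by
    ext y; exact HH.comul_a y
  rw [comul₃, HH.coassoc_map_symm]
  congr 2
  have h2 : TensorProduct.map HH.comul
      ((TensorProduct.map LinearMap.id HH.comul ∘ₗ HH.comul) ∘ₗ HH.a.toLinearMap) ∘ₗ HH.comul
      = (TensorProduct.assoc k _ _ _).symm.toLinearMap ∘ₗ
            TensorProduct.map HH.a.symm.toLinearMap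
              (TensorProduct.map LinearMap.id
                (((TensorProduct.map LinearMap.id HH.comul ∘ₗ HH.comul) ∘ₗ HH.a.toLinearMap) ∘ₗ
                  HH.a.toLinearMap) ∘ₗ HH.comul) ∘ₗ
            HH.comul := by
    ext y
    have := HH.coassoc_map_symm LinearMap.id LinearMap.id
      ((TensorProduct.map LinearMap.id HH.comul ∘ₗ HH.comul) ∘ₗ HH.a.toLinearMap) y
    simpa using this
  have h3 : TensorProduct.map LinearMap.id
                (((TensorProduct.map LinearMap.id HH.comul ∘ₗ HH.comul) ∘ₗ HH.a.toLinearMap) ∘ₗ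
                  HH.a.toLinearMap) ∘ₗ HH.comul
      = (TensorProduct.assoc k _ _ _).toLinearMap ∘ₗ
                TensorProduct.map
                  (TensorProduct.map HH.a.toLinearMap
                    (HH.a.toLinearMap ∘ₗ HH.a.toLinearMap) ∘ₗ HH.comul)
                  (TensorProduct.map HH.a.toLinearMap HH.a.toLinearMap ∘ₗ HH.comul) ∘ₗ
                HH.comul := by
    ext y
    have := HH.coassoc_map LinearMap.id (HH.a.toLinearMap ∘ₗ HH.a.toLinearMap)
      (HH.comul ∘ₗ HH.a.toLinearMap ∘ₗ HH.a.toLinearMap) y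
    have h4 : ((TensorProduct.map LinearMap.id HH.comul ∘ₗ HH.comul) ∘ₗ HH.a.toLinearMap) ∘ₗ
          HH.a.toLinearMap
        = TensorProduct.map (HH.a.toLinearMap ∘ₗ HH.a.toLinearMap)
          (HH.comul ∘ₗ HH.a.toLinearMap ∘ₗ HH.a.toLinearMap) ∘ₗ HH.comul := by
      simp only [LinearMap.comp_assoc, ha]
      simp only [← LinearMap.comp_assoc, ← TensorProduct.map_comp, LinearMap.id_comp]
    rw [LinearMap.comp_apply, h4, this]
    have h5 : (HH.comul ∘ₗ HH.a.toLinearMap ∘ₗ HH.a.toLinearMap) ∘ₗ HH.a.symm.toLinearMap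
        = TensorProduct.map HH.a.toLinearMap HH.a.toLinearMap ∘ₗ HH.comul := by
      rw [← ha]
      ext z
      simp
    rw [h5, LinearMap.id_comp]
    rfl
  rw [← h3, ← h2]
  simp

end HomHopf

namespace IsHomHopfAuto

variable {HH : HomHopf k H} {f g : H ≃ₗ[k] H}

lemma map_a_symm (hf : IsHomHopfAuto HH f) (x : H) : f (HH.a.symm x) = HH.a.symm (f x) := by
  rw [LinearEquiv.eq_symm_apply, ← hf.map_a, HH.a.apply_symm_apply]

lemma map_S_symm (hf : IsHomHopfAuto HH f) (x : H) : f (HH.S.symm x) = HH.S.symm (f x) := by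
  rw [LinearEquiv.eq_symm_apply, ← hf.map_S, HH.S.apply_symm_apply]

lemma trans (hf : IsHomHopfAuto HH f) (hg : IsHomHopfAuto HH g) :
    IsHomHopfAuto HH (f.trans g) where
  map_mul x y := by simp [hf.map_mul, hg.map_mul]
  map_one := by simp [hf.map_one, hg.map_one]
  map_comul x := by
    rw [LinearEquiv.trans_apply, hg.map_comul, hf.map_comul, TensorProduct.map_map]
    rfl
  map_counit x := by simp [hf.map_counit, hg.map_counit]
  map_a x := by simp [hf.map_a, hg.map_a]

lemma symm (hf : IsHomHopfAuto HH f) : IsHomHopfAuto HH f.symm where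
  map_mul x y := by
    apply f.injective
    simp [hf.map_mul]
  map_one := by
    apply f.injective
    simp [hf.map_one]
  map_comul x := by
    conv_rhs => rw [← f.apply_symm_apply x, hf.map_comul, TensorProduct.map_map]
    simp
  map_counit x := by rw [← hf.map_counit, f.apply_symm_apply]
  map_a x := by
    apply f.injective
    simp [hf.map_a]

lemma comul₃ (hf : IsHomHopfAuto HH f) (x : H) : HH.comul₃ (f x)
    = TensorProduct.map f.toLinearMap (TensorProduct.map f.toLinearMap f.toLinearMap)
      (HH.comul₃ x) := by
  rw [HomHopf.comul₃, LinearMap.comp_apply, LinearMap.comp_apply, hf.map_comul,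
    TensorProduct.map_map, TensorProduct.map_map]
  congr 2
  ext y
  exact hf.map_comul y

end IsHomHopfAuto

section Representation

variable {U V : Type*} [AddCommGroup U] [Module k U] [AddCommGroup V] [Module k V]

lemma exists_sum_fin_tmul (u : U ⊗[k] V) :
    ∃ (n : ℕ) (x : Fin n → U) (y : Fin n → V), u = ∑ i, x i ⊗ₜ[k] y i := by
  obtain ⟨s, rfl⟩ := TensorProduct.exists_finset u
  refine ⟨s.card, fun i => (s.equivFin.symm i).1.1, fun i => (s.equivFin.symm i).1.2, ?_⟩
  rw [s.equivFin.symm.sum_comp (fun p => p.1.1 ⊗ₜ[k] p.1.2),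
    Finset.sum_coe_sort s (fun p => p.1 ⊗ₜ[k] p.2)]

lemma exists_sum_fin_tmul_family {n : ℕ} (u : Fin n → U ⊗[k] V) :
    ∃ (p : ℕ) (x : Fin n → Fin p → U) (y : Fin n → Fin p → V),
      ∀ i, u i = ∑ j, x i j ⊗ₜ[k] y i j := by
  obtain ⟨p, x, y, h⟩ := exists_sum_fin_tmul (k := k) (U := Fin n → U) (V := V)
    (∑ i, TensorProduct.map (LinearMap.single k (fun _ => U) i) LinearMap.id (u i))
  refine ⟨p, fun i j => x j i, fun _ j => y j, fun i => ?_⟩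
  have h' := congr(TensorProduct.map (LinearMap.proj i) LinearMap.id $h)
  simp only [map_sum, TensorProduct.map_tmul, LinearMap.proj_apply, LinearMap.id_apply] at h'
  rw [← h', Finset.sum_eq_single i]
  · simp [TensorProduct.map_map, LinearMap.proj_comp_single_same]
  · intro j _ hj
    rw [TensorProduct.map_map, LinearMap.proj_comp_single_ne k _ i j hj.symm]
    simp
  · simp

end Representation

section TensorAct

variable {M N : Type*} [AddCommGroup M] [Module k M] [AddCommGroup N] [Module k N]

/-- The bilinear map sending `h₁ ⊗ h₂` to `m ⊗ n ↦ C(h₁)·m ⊗ E(h₂)·n`. -/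
noncomputable def tensorAct (C E : H ≃ₗ[k] H) (actM : H →ₗ[k] M →ₗ[k] M)
    (actN : H →ₗ[k] N →ₗ[k] N) : H ⊗[k] H →ₗ[k] M ⊗[k] N →ₗ[k] M ⊗[k] N :=
  TensorProduct.homTensorHomMap (RingHom.id k) M N M N ∘ₗ
    TensorProduct.map (actM ∘ₗ C.toLinearMap) (actN ∘ₗ E.toLinearMap)

@[simp] lemma tensorAct_tmul (C E : H ≃ₗ[k] H) (actM : H →ₗ[k] M →ₗ[k] M)
    (actN : H →ₗ[k] N →ₗ[k] N) (x y : H) (m : M) (n : N) :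
    tensorAct C E actM actN (x ⊗ₜ[k] y) (m ⊗ₜ[k] n)
      = actM (C x) m ⊗ₜ[k] actN (E y) n := rfl

end TensorAct

namespace HomHopf

variable (HH : HomHopf k H)
variable {M N : Type*} [AddCommGroup M] [Module k M] [AddCommGroup N] [Module k N]

/-- The right-hand side of the Yetter-Drinfeld condition,
`x ⊗ (y ⊗ z) ⊗ (m ⊗ g) ↦ a(y)·m ⊗ (B(z) a⁻¹(g)) A(S⁻¹(x))`. -/
noncomputable def ydMap (A B : H ≃ₗ[k] H) (act : H →ₗ[k] M →ₗ[k] M) :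
    H ⊗[k] (H ⊗[k] H) →ₗ[k] M ⊗[k] H →ₗ[k] M ⊗[k] H :=
  TensorProduct.lift
    ((TensorProduct.mapBilinear (RingHom.id k) H H (M →ₗ[k] M) (H →ₗ[k] H)
        (act ∘ₗ HH.a.toLinearMap) ∘ₗ
      (LinearMap.llcomp k H H H).compl₁₂
        (HH.mul.flip ∘ₗ A.toLinearMap ∘ₗ HH.S.symm.toLinearMap)
        (LinearMap.lcomp k H HH.a.symm.toLinearMap ∘ₗ HH.mul ∘ₗ B.toLinearMap)).compr₂
      (TensorProduct.homTensorHomMap (RingHom.id k) M H M H))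

@[simp] lemma ydMap_tmul (A B : H ≃ₗ[k] H) (act : H →ₗ[k] M →ₗ[k] M) (x y z g : H) (m : M) :
    HH.ydMap A B act (x ⊗ₜ[k] (y ⊗ₜ[k] z)) (m ⊗ₜ[k] g)
      = act (HH.a y) m ⊗ₜ[k]
        HH.mul (HH.mul (B z) (HH.a.symm g)) (A (HH.S.symm x)) := rfl

/-- The linear map `(m ⊗ g) ⊗ (n ⊗ h) ↦ (m ⊗ n) ⊗ h g`. -/
noncomputable def tensorCoact : (M ⊗[k] H) ⊗[k] (N ⊗[k] H) →ₗ[k] (M ⊗[k] N) ⊗[k] H :=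
  TensorProduct.map LinearMap.id (TensorProduct.lift HH.mul.flip) ∘ₗ
    (TensorProduct.tensorTensorTensorComm k M H N H).toLinearMap

@[simp] lemma tensorCoact_tmul (m : M) (n : N) (g h : H) :
    HH.tensorCoact ((m ⊗ₜ[k] g) ⊗ₜ[k] (n ⊗ₜ[k] h)) = (m ⊗ₜ[k] n) ⊗ₜ[k] HH.mul h g := rfl

end HomHopf

lemma YDModule.coact_act {HH : HomHopf k H} {A B : H ≃ₗ[k] H} {M : Type*} [AddCommGroup M]
    [Module k M] (Y : YDModule HH A B M) (h : H) (m : M) :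
    Y.coact (Y.act h m) = HH.ydMap A B Y.act (HH.comul₃ h) (Y.coact m) := by
  obtain ⟨n, h1, h2, hh⟩ := exists_sum_fin_tmul (k := k) (HH.comul h)
  obtain ⟨p, h21, h22, hh2⟩ := exists_sum_fin_tmul_family (k := k) fun i => HH.comul (h2 i)
  obtain ⟨q, m0, m1, hm⟩ := exists_sum_fin_tmul (k := k) (Y.coact m)
  rw [Y.compat h m n h1 h2 hh p h21 h22 hh2 q m0 m1 hm, HomHopf.comul₃, LinearMap.comp_apply, hh,
    hm]
  simp only [map_sum, LinearMap.sum_apply, TensorProduct.map_tmul, LinearMap.id_apply, hh2,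
    TensorProduct.tmul_sum, HomHopf.ydMap_tmul]
  refine Eq.trans ?_ Finset.sum_comm
  exact Finset.sum_congr rfl fun i _ => Finset.sum_comm

namespace HomHopf

variable (HH : HomHopf k H)

lemma mul_mul_mul_mul_cancel (X Y Z p q : H) :
    HH.mul (HH.mul X (HH.a (HH.a q))) (HH.mul (HH.mul (HH.a p) Y) Z)
      = HH.mul (HH.a X) (HH.mul (HH.a (HH.mul q p)) (HH.mul Y (HH.a.symm Z))) := by
  obtain ⟨Z, rfl⟩ := HH.a.surjective Z
  obtain ⟨Y, rfl⟩ := HH.a.surjective Y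
  obtain ⟨Z, rfl⟩ := HH.a.surjective Z
  rw [← HH.hom_assoc, HH.a.symm_apply_apply, ← HH.a_mul Y Z, ← HH.a_mul (HH.a p), ← HH.hom_assoc,
    HH.hom_assoc (HH.a q), HH.a_mul q p]

lemma mul_mul_assoc (P n m Q : H) :
    HH.mul (HH.mul (HH.a P) (HH.a n)) (HH.mul (HH.a m) (HH.a.symm Q))
      = HH.mul (HH.mul (HH.a P) (HH.mul n m)) Q := by
  rw [← HH.a_mul, HH.hom_assoc, HH.a.apply_symm_apply, HH.hom_assoc P]

variable {M N : Type*} [AddCommGroup M] [Module k M] [AddCommGroup N] [Module k N]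
  {A B C D E : H ≃ₗ[k] H}

/-- The coaction of `h·(m ⊗ n)`, as a function of `(h₁₁ ⊗ h₁₂₁ ⊗ h₁₂₂) ⊗ (h₂₁ ⊗ h₂₂₁ ⊗ h₂₂₂)`
and of the coactions `u` of `m` and `v` of `n`. -/
noncomputable def tensorYdMap (A B C D E : H ≃ₗ[k] H) (actM : H →ₗ[k] M →ₗ[k] M)
    (actN : H →ₗ[k] N →ₗ[k] N) (u : M ⊗[k] H) (v : N ⊗[k] H) :
    (H ⊗[k] (H ⊗[k] H)) ⊗[k] (H ⊗[k] (H ⊗[k] H)) →ₗ[k] (M ⊗[k] N) ⊗[k] H :=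
  HH.tensorCoact ∘ₗ TensorProduct.map
    ((HH.ydMap A B actM).flip u ∘ₗ
      TensorProduct.map C.toLinearMap (TensorProduct.map C.toLinearMap C.toLinearMap))
    ((HH.ydMap C D actN).flip v ∘ₗ
      TensorProduct.map E.toLinearMap (TensorProduct.map E.toLinearMap E.toLinearMap))

/-- The right-hand side of the Yetter-Drinfeld condition for `M ⊗ N` with `h₁` fixed, as a function
of `(h₂₁₁ ⊗ h₂₁₂) ⊗ h₂₂`. -/
noncomputable def tensorYdRight (A C D E : H ≃ₗ[k] H) (actM : H →ₗ[k] M →ₗ[k] M)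
    (actN : H →ₗ[k] N →ₗ[k] N) (t : M ⊗[k] N) (g x : H) :
    (H ⊗[k] H) ⊗[k] H →ₗ[k] (M ⊗[k] N) ⊗[k] H :=
  TensorProduct.map
    ((tensorAct C E actM actN).flip t ∘ₗ TensorProduct.map HH.a.toLinearMap HH.a.toLinearMap)
    (HH.mul.flip (A (C (HH.S.symm x))) ∘ₗ HH.mul.flip (HH.a.symm g) ∘ₗ
      D.toLinearMap ∘ₗ E.toLinearMap)

lemma tensorYdMap_eq_tensorYdRight (hA : IsHomHopfAuto HH A) (hB : IsHomHopfAuto HH B)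
    (hC : IsHomHopfAuto HH C) (hD : IsHomHopfAuto HH D) (hE : IsHomHopfAuto HH E)
    (hCE : ∀ x, C (E x) = B (C x)) (actM : H →ₗ[k] M →ₗ[k] M) (actN : H →ₗ[k] N →ₗ[k] N)
    (m : M) (n : N) (g h x y z r s : H) :
    HH.tensorYdMap A B C D E actM actN (m ⊗ₜ[k] g) (n ⊗ₜ[k] h)
        ((TensorProduct.assoc k _ _ _).symm (HH.a.symm x ⊗ₜ[k]
          (TensorProduct.assoc k _ _ _).symm (HH.a.symm y ⊗ₜ[k]
            TensorProduct.assoc k _ _ _ (TensorProduct.map HH.a.toLinearMap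
              (HH.a.toLinearMap ∘ₗ HH.a.toLinearMap) (HH.comul z) ⊗ₜ[k]
                (HH.a r ⊗ₜ[k] HH.a s)))))
      = HH.counit z • HH.tensorYdRight A C D E actM actN (m ⊗ₜ[k] n) (HH.mul h g) x
        ((HH.a.symm y ⊗ₜ[k] HH.a r) ⊗ₜ[k] HH.a (HH.a s)) := by
  have hW := hC.trans hB
  have key : ∀ u : H ⊗[k] H,
      HH.tensorYdMap A B C D E actM actN (m ⊗ₜ[k] g) (n ⊗ₜ[k] h)
        ((TensorProduct.assoc k _ _ _).symm (HH.a.symm x ⊗ₜ[k]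
          (TensorProduct.assoc k _ _ _).symm (HH.a.symm y ⊗ₜ[k]
            TensorProduct.assoc k _ _ _ (TensorProduct.map HH.a.toLinearMap
              (HH.a.toLinearMap ∘ₗ HH.a.toLinearMap) u ⊗ₜ[k]
                (HH.a r ⊗ₜ[k] HH.a s)))))
      = (actM (C y) m ⊗ₜ[k] actN (E (HH.a (HH.a r))) n) ⊗ₜ[k]
          HH.mul (HH.a (HH.mul (D (E (HH.a s))) (HH.a.symm h)))
            (HH.mul (HH.a (HH.mulAntipodeSymm (TensorProduct.map (C.trans B).toLinearMap
              (C.trans B).toLinearMap u)))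
              (HH.mul (HH.a.symm g) (HH.a.symm (A (HH.S.symm (C (HH.a.symm x))))))) := by
    intro u
    induction u with
    | zero => simp
    | add u v hu hv =>
      simp only [map_add, TensorProduct.add_tmul, TensorProduct.tmul_add, LinearMap.add_apply, hu,
        hv]
    | tmul p q =>
      simp only [TensorProduct.map_tmul, TensorProduct.assoc_tmul, TensorProduct.assoc_symm_tmul,
        tensorYdMap, LinearMap.comp_apply, LinearEquiv.coe_coe, LinearMap.flip_apply, ydMap_tmul,
        tensorCoact_tmul, mulAntipodeSymm_tmul, LinearEquiv.trans_apply]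
      rw [← HH.mul_mul_mul_mul_cancel, ← hC.map_a, HH.a.apply_symm_apply, ← hE.map_a,
        hC.map_S_symm, hCE, hC.map_a, hC.map_a, hC.map_a, hB.map_a, hB.map_a, hB.map_a,
        HH.S_symm_a, HH.S_symm_a]
  rw [key, ← hW.map_comul, HH.mulAntipodeSymm_comul, hW.map_counit]
  simp only [map_smul, LinearMap.smul_apply, TensorProduct.tmul_smul]
  congr 1
  simp only [tensorYdRight, TensorProduct.map_tmul, LinearMap.comp_apply, LinearEquiv.coe_coe,
    LinearMap.flip_apply, tensorAct_tmul, HH.a.apply_symm_apply]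
  congr 1
  rw [HH.a_one, HH.one_mul', HH.a_mul, HH.a_mul, HH.a_symm_mul, hE.map_a (HH.a s), hD.map_a,
    ← HH.mul_mul_assoc, hC.map_S_symm, hC.map_a_symm, HH.S_symm_a_symm, hA.map_a_symm,
    HH.a.apply_symm_apply (HH.a.symm _)]

lemma tensorYdMap_comul₃ (hA : IsHomHopfAuto HH A) (hB : IsHomHopfAuto HH B)
    (hC : IsHomHopfAuto HH C) (hD : IsHomHopfAuto HH D) (hE : IsHomHopfAuto HH E)
    (hCE : ∀ x, C (E x) = B (C x)) (actM : H →ₗ[k] M →ₗ[k] M) (actN : H →ₗ[k] N →ₗ[k] N)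
    (u : M ⊗[k] H) (v : N ⊗[k] H) (x : H) :
    HH.tensorYdMap A B C D E actM actN u v
        (TensorProduct.map HH.comul₃ HH.comul₃ (HH.comul x))
      = HH.ydMap (C.trans A) (E.trans D) (tensorAct C E actM actN ∘ₗ HH.comul) (HH.comul₃ x)
        (HH.tensorCoact (u ⊗ₜ[k] v)) := by
  induction u with
  | zero => simp [tensorYdMap]
  | add u u' hu hu' =>
    rw [TensorProduct.add_tmul, map_add, map_add, ← hu, ← hu']
    simp [tensorYdMap, LinearMap.add_comp, TensorProduct.map_add_left]
  | tmul m g =>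
  induction v with
  | zero => simp [tensorYdMap]
  | add v v' hv hv' =>
    rw [TensorProduct.tmul_add, map_add, map_add, ← hv, ← hv']
    simp [tensorYdMap, LinearMap.add_comp, TensorProduct.map_add_right]
  | tmul n h =>
  rw [HH.comul₃_comul₃_comul, comul₃, LinearMap.comp_apply, tensorCoact_tmul]
  generalize HH.comul x = u
  induction u with
  | zero => simp
  | add u v hu hv => simp only [map_add, LinearMap.add_apply, hu, hv]
  | tmul x y =>
  have hright : HH.ydMap (C.trans A) (E.trans D) (tensorAct C E actM actN ∘ₗ HH.comul)
      (x ⊗ₜ[k] HH.comul y) ((m ⊗ₜ[k] n) ⊗ₜ[k] HH.mul h g)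
      = HH.tensorYdRight A C D E actM actN (m ⊗ₜ[k] n) (HH.mul h g) x
        (TensorProduct.map (TensorProduct.map LinearMap.id LinearMap.id ∘ₗ HH.comul)
          LinearMap.id (HH.comul y)) := by
    generalize HH.comul y = u
    induction u with
    | zero => simp
    | add u v hu hv => simp only [map_add, TensorProduct.tmul_add, LinearMap.add_apply, hu, hv]
    | tmul p q => simp [tensorYdRight, HH.comul_a]
  rw [TensorProduct.map_tmul, TensorProduct.map_tmul, LinearMap.id_apply, hright,
    HH.coassoc_map_symm, LinearMap.comp_apply, LinearMap.comp_apply]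
  generalize HH.comul y = u
  induction u with
  | zero => simp
  | add u v hu hv => simp only [map_add, TensorProduct.tmul_add, hu, hv]
  | tmul y z =>
  simp only [TensorProduct.map_tmul, LinearMap.comp_apply, LinearEquiv.coe_coe,
    LinearMap.id_apply]
  conv_rhs => rw [← HH.a.apply_symm_apply z, HH.comul_a, ← HH.counit_comul z]
  generalize HH.comul z = u
  induction u with
  | zero => simp
  | add u v hu hv => simp only [map_add, TensorProduct.tmul_add, hu, hv]
  | tmul z w =>
  simp only [TensorProduct.map_tmul, LinearMap.comp_apply, TensorProduct.lid_tmul,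
    LinearMap.id_apply, map_smul, TensorProduct.tmul_smul]
  generalize HH.comul w = u
  induction u with
  | zero => simp
  | add u v hu hv => simp only [map_add, TensorProduct.tmul_add, smul_add, hu, hv]
  | tmul r s =>
  simp only [TensorProduct.map_tmul, LinearEquiv.coe_coe, LinearMap.id_comp]
  exact HH.tensorYdMap_eq_tensorYdRight hA hB hC hD hE hCE actM actN m n g h x y z r s

/-- The linear map underlying the coassociativity of the tensor product coaction,
`(m ⊗ g) ⊗ (n ⊗ h) ↦ (m ⊗ n) ⊗ h g` with `g h : H ⊗ H`. -/
noncomputable def tensorCoact₂ :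
    (M ⊗[k] (H ⊗[k] H)) ⊗[k] (N ⊗[k] (H ⊗[k] H)) →ₗ[k] (M ⊗[k] N) ⊗[k] (H ⊗[k] H) :=
  TensorProduct.map LinearMap.id
      (TensorProduct.map (TensorProduct.lift HH.mul.flip) (TensorProduct.lift HH.mul.flip) ∘ₗ
        (TensorProduct.tensorTensorTensorComm k H H H H).toLinearMap) ∘ₗ
    (TensorProduct.tensorTensorTensorComm k M (H ⊗[k] H) N (H ⊗[k] H)).toLinearMap

@[simp] lemma tensorCoact₂_tmul (m : M) (n : N) (g g' h h' : H) :
    HH.tensorCoact₂ ((m ⊗ₜ[k] (g ⊗ₜ[k] g')) ⊗ₜ[k] (n ⊗ₜ[k] (h ⊗ₜ[k] h')))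
      = (m ⊗ₜ[k] n) ⊗ₜ[k] (HH.mul h g ⊗ₜ[k] HH.mul h' g') := rfl

lemma map_comul_tensorCoact {M' N' : Type*} [AddCommGroup M'] [Module k M'] [AddCommGroup N']
    [Module k N'] (f : M →ₗ[k] M') (f' : N →ₗ[k] N') (u : M ⊗[k] H) (v : N ⊗[k] H) :
    TensorProduct.map (TensorProduct.map f f') HH.comul (HH.tensorCoact (u ⊗ₜ[k] v))
      = HH.tensorCoact₂ (TensorProduct.map f HH.comul u ⊗ₜ[k] TensorProduct.map f' HH.comul v) := by
  induction u with
  | zero => simp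
  | add u u' hu hu' => simp only [map_add, TensorProduct.add_tmul, hu, hu']
  | tmul m g =>
  induction v with
  | zero => simp
  | add v v' hv hv' => simp only [map_add, TensorProduct.tmul_add, hv, hv']
  | tmul n h =>
  simp only [tensorCoact_tmul, TensorProduct.map_tmul, HH.comul_mul]
  generalize HH.comul g = u
  generalize HH.comul h = v
  induction u with
  | zero => simp
  | add u u' hu hu' => simp only [map_add, TensorProduct.add_tmul, TensorProduct.tmul_add, hu, hu']
  | tmul x y =>
  induction v with
  | zero => simp
  | add v v' hv hv' => simp only [map_add, TensorProduct.add_tmul, TensorProduct.tmul_add, hv, hv']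
  | tmul z w => simp

lemma assoc_map_tensorCoact (cM : M →ₗ[k] M ⊗[k] H) (cN : N →ₗ[k] N ⊗[k] H)
    (u : M ⊗[k] H) (v : N ⊗[k] H) :
    TensorProduct.assoc k (M ⊗[k] N) H H
        (TensorProduct.map (HH.tensorCoact ∘ₗ TensorProduct.map cM cN) HH.a.symm.toLinearMap
          (HH.tensorCoact (u ⊗ₜ[k] v)))
      = HH.tensorCoact₂
        (TensorProduct.assoc k M H H (TensorProduct.map cM HH.a.symm.toLinearMap u) ⊗ₜ[k]
          TensorProduct.assoc k N H H (TensorProduct.map cN HH.a.symm.toLinearMap v)) := by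
  induction u with
  | zero => simp
  | add u u' hu hu' => simp only [map_add, TensorProduct.add_tmul, hu, hu']
  | tmul m g =>
  induction v with
  | zero => simp
  | add v v' hv hv' => simp only [map_add, TensorProduct.tmul_add, hv, hv']
  | tmul n h =>
  simp only [tensorCoact_tmul, TensorProduct.map_tmul, LinearMap.comp_apply, LinearEquiv.coe_coe,
    HH.a_symm_mul]
  generalize cM m = u
  generalize cN n = v
  induction u with
  | zero => simp
  | add u u' hu hu' => simp only [map_add, TensorProduct.add_tmul, hu, hu']
  | tmul x y =>
  induction v with
  | zero => simp
  | add v v' hv hv' => simp only [map_add, TensorProduct.add_tmul, TensorProduct.tmul_add, hv, hv']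
  | tmul z w => simp

end HomHopf

/-- The tensor product of an `(A,B)`- and a `(C,D)`-Yetter-Drinfeld Hom-module, where `E` plays the
role of `C⁻¹BC`. -/
noncomputable def YDModule.tensor {HH : HomHopf k H} {A B C D E : H ≃ₗ[k] H}
    {M N : Type*} [AddCommGroup M] [Module k M] [AddCommGroup N] [Module k N]
    (hA : IsHomHopfAuto HH A) (hB : IsHomHopfAuto HH B)
    (hC : IsHomHopfAuto HH C) (hD : IsHomHopfAuto HH D) (hE : IsHomHopfAuto HH E)
    (hCE : ∀ x, C (E x) = B (C x)) (YM : YDModule HH A B M) (YN : YDModule HH C D N) :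
    YDModule HH (C.trans A) (E.trans D) (M ⊗[k] N) where
  act := tensorAct C E YM.act YN.act ∘ₗ HH.comul
  coact := HH.tensorCoact ∘ₗ TensorProduct.map YM.coact YN.coact
  mu := TensorProduct.congr YM.mu YN.mu
  hom_act h g t := by
    simp only [LinearMap.comp_apply, HH.comul_a, HH.comul_mul]
    generalize HH.comul h = u
    generalize HH.comul g = v
    induction t with
    | zero => simp
    | add t t' ht ht' => simp only [map_add, ht, ht']
    | tmul m n =>
    induction u with
    | zero => simp
    | add u u' hu hu' => simp only [map_add, TensorProduct.add_tmul, LinearMap.add_apply, hu, hu']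
    | tmul x y =>
    induction v with
    | zero => simp
    | add v v' hv hv' => simp only [map_add, TensorProduct.tmul_add, LinearMap.add_apply, hv, hv']
    | tmul z w => simp [hC.map_a, hE.map_a, hC.map_mul, hE.map_mul, YM.hom_act, YN.hom_act]
  mu_act h t := by
    simp only [LinearMap.comp_apply, HH.comul_a]
    generalize HH.comul h = u
    induction t with
    | zero => simp
    | add t t' ht ht' => simp only [map_add, ht, ht']
    | tmul m n =>
    induction u with
    | zero => simp
    | add u u' hu hu' => simp only [map_add, LinearMap.add_apply, hu, hu']
    | tmul x y => simp [hC.map_a, hE.map_a, YM.mu_act, YN.mu_act]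
  one_act t := by
    simp only [LinearMap.comp_apply, HH.comul_one]
    induction t with
    | zero => simp
    | add t t' ht ht' => simp only [map_add, ht, ht']
    | tmul m n => simp [hC.map_one, hE.map_one, YM.one_act, YN.one_act]
  hom_coact := by
    ext m n
    have hM := congr($(YM.hom_coact) m)
    have hN := congr($(YN.hom_coact) n)
    simp only [LinearMap.comp_apply, LinearEquiv.coe_coe] at hM hN
    have h := HH.map_comul_tensorCoact YM.mu.symm.toLinearMap YN.mu.symm.toLinearMap
      (YM.coact m) (YN.coact n)
    rw [hM, hN, ← HH.assoc_map_tensorCoact] at h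
    exact h
  coact_mu t := by
    induction t with
    | zero => simp
    | add t t' ht ht' => simp only [map_add, ht, ht']
    | tmul m n =>
    simp only [LinearMap.comp_apply, TensorProduct.congr_tmul, TensorProduct.map_tmul,
      YM.coact_mu, YN.coact_mu]
    generalize YM.coact m = u
    generalize YN.coact n = v
    induction u with
    | zero => simp
    | add u u' hu hu' => simp only [map_add, TensorProduct.add_tmul, hu, hu']
    | tmul x y =>
    induction v with
    | zero => simp
    | add v v' hv hv' => simp only [map_add, TensorProduct.tmul_add, hv, hv']
    | tmul z w => simp [HH.a_mul]
  coact_counit t := by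
    induction t with
    | zero => simp
    | add t t' ht ht' => simp only [map_add, ht, ht']
    | tmul m n =>
    rw [TensorProduct.congr_symm_tmul, ← YM.coact_counit, ← YN.coact_counit,
      LinearMap.comp_apply, TensorProduct.map_tmul]
    generalize YM.coact m = u
    generalize YN.coact n = v
    induction u with
    | zero => simp
    | add u u' hu hu' => simp only [map_add, TensorProduct.add_tmul, hu, hu']
    | tmul x y =>
    induction v with
    | zero => simp
    | add v v' hv hv' => simp only [map_add, TensorProduct.tmul_add, hv, hv']
    | tmul z w => simp [HH.counit_mul, TensorProduct.smul_tmul', TensorProduct.tmul_smul, mul_smul]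
  compat h t n h1 h2 hh p h21 h22 hh2 q m0 m1 ht := by
    have key : ∀ t, HH.tensorCoact (TensorProduct.map YM.coact YN.coact
        (tensorAct C E YM.act YN.act (HH.comul h) t))
        = HH.ydMap (C.trans A) (E.trans D) (tensorAct C E YM.act YN.act ∘ₗ HH.comul) (HH.comul₃ h)
          (HH.tensorCoact (TensorProduct.map YM.coact YN.coact t)) := by
      intro t
      induction t with
      | zero => simp
      | add t t' ht ht' => simp only [map_add, ht, ht']
      | tmul m n =>
      rw [TensorProduct.map_tmul, ← HH.tensorYdMap_comul₃ hA hB hC hD hE hCE]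
      generalize HH.comul h = u
      induction u with
      | zero => simp
      | add u u' hu hu' => simp only [map_add, LinearMap.add_apply, hu, hu']
      | tmul x y =>
        rw [tensorAct_tmul, TensorProduct.map_tmul, YM.coact_act, YN.coact_act, hC.comul₃,
          hE.comul₃]
        rfl
    simp only [LinearMap.comp_apply] at ht
    simp only [LinearMap.comp_apply, key, ht]
    rw [HomHopf.comul₃, LinearMap.comp_apply, hh]
    simp only [map_sum, LinearMap.sum_apply, TensorProduct.map_tmul, LinearMap.id_apply, hh2,
      TensorProduct.tmul_sum, HomHopf.ydMap_tmul, LinearMap.comp_apply]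
    refine Finset.sum_comm.trans ?_
    exact Finset.sum_congr rfl fun i _ => Finset.sum_comm

end Untwist

/-- Proposition 3.1: the tensor product of an (A,B)- and a (C,D)-Yetter-Drinfeld
Hom-module, with action h·(m⊗n) = C(h₁)·m ⊗ (C⁻¹BC)(h₂)·n and coaction
m⊗n ↦ (m₍₀₎⊗n₍₀₎) ⊗ n₍₁₎m₍₁₎, is an (AC, DC⁻¹BC)-Yetter-Drinfeld Hom-module
with structure automorphism μ⊗ν. -/
theorem stmt_9 {k : Type*} [Field k] {H : Type*} [AddCommGroup H] [Module k H]
    {M : Type*} [AddCommGroup M] [Module k M] {N : Type*} [AddCommGroup N] [Module k N]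
    (HH : HomHopf k H) (A B C D : H ≃ₗ[k] H)
    (hA : IsHomHopfAuto HH A) (hB : IsHomHopfAuto HH B)
    (hC : IsHomHopfAuto HH C) (hD : IsHomHopfAuto HH D)
    (YM : YDModule HH A B M) (YN : YDModule HH C D N)
    (act : H →ₗ[k] (M ⊗[k] N) →ₗ[k] (M ⊗[k] N))
    (hact : ∀ (h : H) (m : M) (x : N) (n : ℕ) (h1 h2 : Fin n → H),
      HH.comul h = ∑ i, h1 i ⊗ₜ[k] h2 i →
      act h (m ⊗ₜ[k] x)
        = ∑ i, YM.act (C (h1 i)) m ⊗ₜ[k] YN.act (C.symm (B (C (h2 i)))) x)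
    (coact : (M ⊗[k] N) →ₗ[k] (M ⊗[k] N) ⊗[k] H)
    (hcoact : ∀ (m : M) (x : N) (q : ℕ) (m0 : Fin q → M) (m1 : Fin q → H),
      YM.coact m = ∑ l, m0 l ⊗ₜ[k] m1 l →
      ∀ (r : ℕ) (n0 : Fin r → N) (n1 : Fin r → H),
      YN.coact x = ∑ t, n0 t ⊗ₜ[k] n1 t →
      coact (m ⊗ₜ[k] x)
        = ∑ l, ∑ t, (m0 l ⊗ₜ[k] n0 t) ⊗ₜ[k] HH.mul (n1 t) (m1 l)) :
    ∃ Y : YDModule HH (C.trans A) (((C.trans B).trans C.symm).trans D) (M ⊗[k] N),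
      Y.act = act ∧ Y.coact = coact ∧ Y.mu = TensorProduct.congr YM.mu YN.mu := by
  have hact' : act = tensorAct C ((C.trans B).trans C.symm) YM.act YN.act ∘ₗ HH.comul := by
    ext h m x
    obtain ⟨n, h1, h2, hh⟩ := exists_sum_fin_tmul (k := k) (HH.comul h)
    simp [hact h m x n h1 h2 hh, hh]
  have hcoact' : coact = HH.tensorCoact ∘ₗ TensorProduct.map YM.coact YN.coact := by
    ext m x
    obtain ⟨q, m0, m1, hm⟩ := exists_sum_fin_tmul (k := k) (YM.coact m)
    obtain ⟨r, n0, n1, hn⟩ := exists_sum_fin_tmul (k := k) (YN.coact x)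
    simp [hcoact m x q m0 m1 hm r n0 n1 hn, hm, hn, TensorProduct.sum_tmul, TensorProduct.tmul_sum]
    exact Finset.sum_comm
  exact ⟨YM.tensor hA hB hC hD ((hC.trans hB).trans hC.symm) (by simp) YN,
    hact'.symm, hcoact'.symm, rfl⟩
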